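/- arXiv:2108.08410 — 4 statements merged into one kernel-verified Lean document; each statement's English description precedes it below -/
import Mathlib

section
/- For each fixed integer k ≥ 4, the limsup as r → ∞ of R_r(k) · ((k−2)!)^r / (r(k−2))! is at most (3+e)/2; equivalently, R_r(k) ≤ ((3+e)/2) · (r(k−2))!/((k−2)!)^r · (1 + o(1)) as r → ∞. -/
/-- A coloring `C` of the edges of the complete graph on `Fin N` has a monochromatic
clique of size `m` in color `i`. -/
def MonochromaticClique {N r : ℕ} (C : Sym2 (Fin N) → Fin r) (i : Fin r) (m : ℕ) : Prop :=
  ∃ S : Finset (Fin N), S.card = m ∧ ∀ x ∈ S, ∀ y ∈ S, x ≠ y → C s(x, y) = i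

/-- `N` vertices suffice: every `r`-coloring of the edges of the complete graph on `N`
vertices yields, for some color `i`, a monochromatic clique on `k i` vertices in color `i`. -/
def RamseyProp (N r : ℕ) (k : Fin r → ℕ) : Prop :=
  ∀ C : Sym2 (Fin N) → Fin r, ∃ i : Fin r, MonochromaticClique C i (k i)

/-- The Ramsey number `R_r(k_1, …, k_r)`: the least `N` such that every `r`-coloring of the
edges of the complete graph on `N` vertices yields a monochromatic clique on `k i` vertices
in some color `i`. -/
noncomputable def ramseyNumber (r : ℕ) (k : Fin r → ℕ) : ℕ :=
  sInf {N | RamseyProp N r k}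

open Finset

/-- The multinomial coefficient `(∑ b i)! / ∏ (b i)!` as a real number. -/
noncomputable def realMultinomial {r : ℕ} (b : Fin r → ℕ) : ℝ :=
  ((∑ i, b i).factorial : ℝ) / ∏ i, ((b i).factorial : ℝ)

/-- The sum of the multinomial coefficients over the box below `a`. -/
noncomputable def boxSum {r : ℕ} (a : Fin r → ℕ) : ℝ :=
  ∑ b ∈ Iic a, realMultinomial b

/-- The sum of the multinomial coefficients of degree `n` over the box below `a`. -/
noncomputable def layerSum {r : ℕ} (a : Fin r → ℕ) (n : ℕ) : ℝ :=
  ∑ b ∈ Iic a with ∑ i, b i = n, realMultinomial b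

lemma realMultinomial_pos {r : ℕ} (b : Fin r → ℕ) : 0 < realMultinomial b := by
  unfold realMultinomial
  positivity

lemma sum_add_single {r : ℕ} (b : Fin r → ℕ) (i : Fin r) :
    ∑ j, (b + Pi.single i 1 : Fin r → ℕ) j = ∑ j, b j + 1 := by
  simp [Finset.sum_add_distrib]

lemma realMultinomial_add_single {r : ℕ} (b : Fin r → ℕ) (i : Fin r) :
    realMultinomial (b + Pi.single i 1) * (b i + 1) = realMultinomial b * (∑ j, b j + 1 : ℕ) := by
  have hprod : ∏ j, (((b + Pi.single i 1 : Fin r → ℕ) j).factorial : ℝ)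
      = (b i + 1) * ∏ j, ((b j).factorial : ℝ) := by
    rw [← Finset.mul_prod_erase _ _ (mem_univ i),
      ← Finset.mul_prod_erase univ (fun j => ((b j).factorial : ℝ)) (mem_univ i), ← mul_assoc]
    congr 1
    · simp [Nat.factorial_succ]
    · refine Finset.prod_congr rfl fun j hj => ?_
      simp [Pi.single_eq_of_ne (ne_of_mem_erase hj)]
  unfold realMultinomial
  rw [hprod, sum_add_single, Nat.factorial_succ]
  have : (0 : ℝ) < ∏ j, ((b j).factorial : ℝ) := by positivity
  push_cast
  field_simp

lemma sub_single_add_single {r : ℕ} {b : Fin r → ℕ} {i : Fin r} (h : 0 < b i) :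
    b - Pi.single i 1 + Pi.single i 1 = b := by
  refine tsub_add_cancel_of_le fun j => ?_
  rcases eq_or_ne j i with rfl | hj
  · simpa using Nat.succ_le_of_lt h
  · simp [Pi.single_eq_of_ne hj]

lemma realMultinomial_sub_single {r : ℕ} {b : Fin r → ℕ} {i : Fin r} (h : 0 < b i) :
    realMultinomial (b - Pi.single i 1) * (∑ j, b j : ℕ) = realMultinomial b * b i := by
  have key := realMultinomial_add_single (b - Pi.single i 1 : Fin r → ℕ) i
  rw [← sum_add_single, sub_single_add_single h] at key
  rw [← key]
  have : (((b - Pi.single i 1 : Fin r → ℕ) i : ℕ) : ℝ) + 1 = b i := by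
    have : (b - Pi.single i 1 : Fin r → ℕ) i + 1 = b i := by simp; omega
    exact_mod_cast this
  rw [this]

lemma sum_Iic_lt_eq_sum_Iic_pos {r : ℕ} (a : Fin r → ℕ) (i : Fin r) (f : (Fin r → ℕ) → ℝ) :
    ∑ b ∈ Iic a with b i < a i, f b = ∑ b ∈ Iic a with 0 < b i, f (b - Pi.single i 1) := by
  refine Finset.sum_nbij' (fun b => b + Pi.single i 1) (fun b => b - Pi.single i 1) ?_ ?_ ?_ ?_ ?_
  · intro b hb
    simp only [mem_filter, mem_Iic] at hb ⊢
    refine ⟨fun j => ?_, by simp⟩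
    rcases eq_or_ne j i with rfl | hj
    · simpa using hb.2
    · simpa [Pi.single_eq_of_ne hj] using hb.1 j
  · intro b hb
    simp only [mem_filter, mem_Iic] at hb ⊢
    refine ⟨tsub_le_self.trans hb.1, ?_⟩
    simp only [Pi.sub_apply, Pi.single_eq_same]
    exact (Nat.sub_lt hb.2 one_pos).trans_le (hb.1 i)
  · intro b _
    simp
  · intro b hb
    exact sub_single_add_single (mem_filter.mp hb).2
  · intro b _
    simp

lemma boxSum_sub_single {r : ℕ} {a : Fin r → ℕ} {i : Fin r} (h : 0 < a i) :
    boxSum (a - Pi.single i 1) = ∑ b ∈ Iic a with b i < a i, realMultinomial b := by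
  unfold boxSum
  congr 1
  ext b
  simp only [mem_filter, mem_Iic, Pi.le_def, Pi.sub_apply]
  constructor
  · intro hb
    refine ⟨fun j => (hb j).trans (Nat.sub_le _ _), ?_⟩
    have := hb i
    simp only [Pi.single_eq_same] at this
    omega
  · rintro ⟨hb, hi⟩ j
    rcases eq_or_ne j i with rfl | hj
    · simp only [Pi.single_eq_same]
      omega
    · simpa [Pi.single_eq_of_ne hj] using hb j

lemma boxSum_eq {r : ℕ} (a : Fin r → ℕ) :
    boxSum a = 1 + ∑ i with 0 < a i, boxSum (a - Pi.single i 1) := by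
  have h1 : ∑ i with 0 < a i, boxSum (a - Pi.single i 1)
      = ∑ i, ∑ b ∈ Iic a with b i < a i, realMultinomial b := by
    rw [Finset.sum_filter]
    refine Finset.sum_congr rfl fun i _ => ?_
    split_ifs with h
    · exact boxSum_sub_single h
    · rw [Finset.filter_eq_empty_iff.mpr, Finset.sum_empty]
      intro b _
      omega
  have h2 : ∀ i, ∑ b ∈ Iic a with b i < a i, realMultinomial b
      = ∑ b ∈ Iic a, realMultinomial b * b i / (∑ j, b j : ℕ) := by
    intro i
    rw [sum_Iic_lt_eq_sum_Iic_pos, Finset.sum_filter]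
    refine Finset.sum_congr rfl fun b _ => ?_
    split_ifs with h
    · have hs : 0 < ∑ j, b j := h.trans_le (Finset.single_le_sum (fun _ _ => Nat.zero_le _) (mem_univ i))
      rw [← realMultinomial_sub_single h]
      field_simp
    · simp [Nat.eq_zero_of_not_pos h]
  rw [h1, Finset.sum_congr rfl fun i _ => h2 i, Finset.sum_comm]
  have h3 : ∀ b : Fin r → ℕ, ∑ i, realMultinomial b * b i / (∑ j, b j : ℕ)
      = realMultinomial b - if b = 0 then 1 else 0 := by
    intro b
    rw [← Finset.sum_div, ← Finset.mul_sum, ← Nat.cast_sum]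
    split_ifs with h
    · subst h
      simp [realMultinomial]
    · have : (∑ j, b j) ≠ 0 := by
        contrapose! h
        ext j
        simpa using (Finset.sum_eq_zero_iff.mp h) j (mem_univ j)
      field_simp
      simp
  rw [Finset.sum_congr rfl fun b _ => h3 b, Finset.sum_sub_distrib]
  simp [boxSum]

lemma one_le_boxSum {r : ℕ} (a : Fin r → ℕ) : 1 ≤ boxSum a := by
  rw [boxSum_eq]
  exact le_add_of_nonneg_right (Finset.sum_nonneg fun i _ =>
    Finset.sum_nonneg fun b _ => (realMultinomial_pos b).le)

lemma exists_clique_of_boxSum_lt_card {V : Type*} [DecidableEq V] {r : ℕ} (C : Sym2 V → Fin r)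
    (a : Fin r → ℕ) (A : Finset V) (hA : boxSum a < A.card) :
    ∃ i, ∃ S ⊆ A, S.card = a i + 2 ∧ ∀ x ∈ S, ∀ y ∈ S, x ≠ y → C s(x, y) = i := by
  induction hn : ∑ i, a i using Nat.strong_induction_on generalizing a A with
  | _ n ih =>
  obtain ⟨v, hv⟩ : A.Nonempty := by
    rw [← Finset.card_pos]
    exact_mod_cast (zero_le_one.trans (one_le_boxSum a)).trans_lt hA
  have extend : ∀ (i : Fin r) (S : Finset V), S ⊆ {w ∈ A.erase v | C s(v, w) = i} →
      (∀ x ∈ S, ∀ y ∈ S, x ≠ y → C s(x, y) = i) →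
      insert v S ⊆ A ∧ (insert v S).card = S.card + 1 ∧
        ∀ x ∈ insert v S, ∀ y ∈ insert v S, x ≠ y → C s(x, y) = i := by
    intro i S hS hc
    have hSv : ∀ w ∈ S, (w ≠ v ∧ w ∈ A) ∧ C s(v, w) = i := fun w hw => by
      simpa using hS hw
    refine ⟨Finset.insert_subset hv fun w hw => (hSv w hw).1.2,
      Finset.card_insert_of_notMem fun h => (hSv v h).1.1 rfl, ?_⟩
    intro x hx y hy hxy
    rcases Finset.mem_insert.mp hx with rfl | hxS <;>
      rcases Finset.mem_insert.mp hy with rfl | hyS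
    · exact absurd rfl hxy
    · exact (hSv y hyS).2
    · rw [Sym2.eq_swap]
      exact (hSv x hxS).2
    · exact hc x hxS y hyS hxy
  by_contra hcon
  have hzero : ∀ i, ¬ 0 < a i → ({w ∈ A.erase v | C s(v, w) = i} : Finset V) = ∅ := by
    intro i hi
    by_contra hne
    obtain ⟨w, hw⟩ := Finset.nonempty_iff_ne_empty.mpr hne
    obtain ⟨h1, h2, h3⟩ := extend i {w} (by simpa using hw) (by simp_all)
    exact hcon ⟨i, _, h1, by simp [h2, Nat.eq_zero_of_not_pos hi], h3⟩
  have hpos : ∀ i, 0 < a i →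
      (({w ∈ A.erase v | C s(v, w) = i} : Finset V).card : ℝ) ≤ boxSum (a - Pi.single i 1) := by
    intro i hi
    by_contra! hlt
    have hs := sum_add_single (a - Pi.single i 1) i
    rw [sub_single_add_single hi] at hs
    obtain ⟨j, S, hS, hcard, hc⟩ := ih _ (by omega) _ _ hlt rfl
    rcases eq_or_ne j i with rfl | hj
    · obtain ⟨h1, h2, h3⟩ := extend j S hS hc
      refine hcon ⟨j, _, h1, ?_, h3⟩
      rw [h2, hcard]
      simp only [Pi.sub_apply, Pi.single_eq_same]
      omega
    · refine hcon ⟨j, S, fun w hw => ?_, ?_, hc⟩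
      · exact Finset.mem_of_mem_erase (Finset.mem_filter.mp (hS hw)).1
      · simpa [Pi.single_eq_of_ne hj] using hcard
  have hcount : (A.card : ℝ)
      = 1 + ∑ i, (({w ∈ A.erase v | C s(v, w) = i} : Finset V).card : ℝ) := by
    rw [← Finset.card_erase_add_one hv,
      Finset.card_eq_sum_card_fiberwise (f := fun w => C s(v, w)) (t := univ) (by simp)]
    push_cast
    ring
  rw [hcount, boxSum_eq, add_lt_add_iff_left, ← not_le] at hA
  refine hA ?_
  rw [Finset.sum_filter]
  refine Finset.sum_le_sum fun i _ => ?_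
  split_ifs with hi
  · exact hpos i hi
  · simp [hzero i hi]

lemma ramseyNumber_le {r : ℕ} (a : Fin r → ℕ) :
    (ramseyNumber r (fun i => a i + 2) : ℝ) ≤ boxSum a + 1 := by
  have h : ramseyNumber r (fun i => a i + 2) ≤ ⌊boxSum a⌋₊ + 1 := by
    refine Nat.sInf_le fun C => ?_
    obtain ⟨i, S, -, h⟩ := exists_clique_of_boxSum_lt_card C a univ
      (by simpa using Nat.lt_floor_add_one (boxSum a))
    exact ⟨i, S, h⟩
  calc (ramseyNumber r (fun i => a i + 2) : ℝ) ≤ (⌊boxSum a⌋₊ + 1 : ℕ) := by exact_mod_cast h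
    _ ≤ boxSum a + 1 := by
      push_cast
      gcongr
      exact Nat.floor_le (zero_le_one.trans (one_le_boxSum a))

lemma layerSum_le_layerSum_succ {r m s n : ℕ} (hn : n + 1 + s = r * m) :
    (s + 1) * layerSum (fun _ : Fin r => m) n ≤
      min (m : ℝ) (1 + (m - 1) * s / (n + 1 : ℕ)) * layerSum (fun _ : Fin r => m) (n + 1) := by
  set a : Fin r → ℕ := fun _ => m with ha
  have hl : (s + 1) * layerSum a n
      = ∑ i, ∑ b ∈ Iic a with b i < a i,
          if ∑ j, b j = n then ((m : ℝ) - b i) * realMultinomial b else 0 := by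
    unfold layerSum
    rw [Finset.mul_sum, Finset.sum_filter]
    simp_rw [Finset.sum_filter]
    rw [Finset.sum_comm]
    refine Finset.sum_congr rfl fun b hb => ?_
    split_ifs with h
    · have : ∀ i, (if b i < a i then ((m : ℝ) - b i) * realMultinomial b else 0)
          = ((m : ℝ) - b i) * realMultinomial b := by
        intro i
        split_ifs with hi
        · rfl
        · have : b i = m := le_antisymm (mem_Iic.mp hb i) (not_lt.mp hi)
          simp [this]
      rw [Finset.sum_congr rfl fun i _ => this i, ← Finset.sum_mul]
      congr 1
      rw [Finset.sum_sub_distrib, ← Nat.cast_sum univ b, h]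
      have : (n : ℝ) + 1 + s = r * m := by exact_mod_cast hn
      simp
      linarith
    · simp
  have hr : ∀ i, (∑ b ∈ Iic a with b i < a i,
          if ∑ j, b j = n then ((m : ℝ) - b i) * realMultinomial b else 0)
      = ∑ b ∈ Iic a with ∑ j, b j = n + 1,
          ((m : ℝ) - b i + 1) * b i / (n + 1 : ℕ) * realMultinomial b := by
    intro i
    rw [sum_Iic_lt_eq_sum_Iic_pos, Finset.sum_filter, Finset.sum_filter]
    refine Finset.sum_congr rfl fun b hb => ?_
    by_cases h : 0 < b i
    · have hs := sum_add_single (b - Pi.single i 1 : Fin r → ℕ) i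
      rw [sub_single_add_single h] at hs
      have hc : (((b - Pi.single i 1 : Fin r → ℕ) i : ℕ) : ℝ) = b i - 1 := by
        simp [Nat.cast_sub (Nat.succ_le_of_lt h)]
      by_cases hbn : ∑ j, b j = n + 1
      · have hbn' : ∑ j, (b - Pi.single i 1 : Fin r → ℕ) j = n := by omega
        have key := realMultinomial_sub_single h
        rw [hbn] at key
        rw [if_pos h, if_pos hbn, if_pos hbn', hc]
        have : ((n + 1 : ℕ) : ℝ) ≠ 0 := by positivity
        field_simp
        linear_combination (m - b i + 1 : ℝ) * key
      · have hbn' : ∑ j, (b - Pi.single i 1 : Fin r → ℕ) j ≠ n := by omega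
        rw [if_pos h, if_neg hbn, if_neg hbn']
    · simp [Nat.eq_zero_of_not_pos h]
  rw [hl, Finset.sum_congr rfl fun i _ => hr i, Finset.sum_comm]
  unfold layerSum
  rw [Finset.mul_sum]
  refine Finset.sum_le_sum fun b hb => ?_
  rw [← Finset.sum_mul]
  refine mul_le_mul_of_nonneg_right ?_ (realMultinomial_pos b).le
  obtain ⟨hba, hbn⟩ := mem_filter.mp hb
  have hbm : ∀ i, b i ≤ m := fun i => mem_Iic.mp hba i
  have hbn' : ∑ i, (b i : ℝ) = (n + 1 : ℕ) := by rw [← Nat.cast_sum, hbn]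
  have hpos : (0 : ℝ) < (n + 1 : ℕ) := by positivity
  rw [← Finset.sum_div, div_le_iff₀ hpos, min_mul_of_nonneg _ _ hpos.le, le_min_iff]
  constructor
  · rw [← hbn', Finset.mul_sum]
    refine Finset.sum_le_sum fun i _ => ?_
    rcases Nat.eq_zero_or_pos (b i) with h | h
    · simp [h]
    · have : (1 : ℝ) ≤ b i := by exact_mod_cast h
      nlinarith
  · have hsum : ∑ i, ((b i : ℝ) + (m - 1) * (m - b i))
        = (1 + (m - 1) * s / (n + 1 : ℕ)) * (n + 1 : ℕ) := by
      have : ((n + 1 : ℕ) : ℝ) + s = r * m := by exact_mod_cast hn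
      rw [Finset.sum_add_distrib, ← Finset.mul_sum, Finset.sum_sub_distrib, hbn', add_mul, one_mul,
        div_mul_cancel₀ _ hpos.ne', Finset.sum_const, card_univ, Fintype.card_fin, nsmul_eq_mul,
        ← this]
      ring
    rw [← hsum]
    refine Finset.sum_le_sum fun i _ => ?_
    rcases (hbm i).eq_or_lt with h | h
    · simp [h]
    · have : (b i : ℝ) + 1 ≤ m := by exact_mod_cast h
      nlinarith

/-- A bound, uniform in `r`, for the ratio of successive layer sums. -/
noncomputable def layerBound (m r s : ℕ) : ℝ :=
  ∏ t ∈ range s, min (m : ℝ) (1 + (m - 1) * t / (r * m - t : ℕ)) / (t + 1)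

lemma layerSum_top (m r : ℕ) :
    layerSum (fun _ : Fin r => m) (r * m) = realMultinomial (fun _ : Fin r => m) := by
  unfold layerSum
  have : ({b ∈ Iic (fun _ : Fin r => m) | ∑ i, b i = r * m} : Finset (Fin r → ℕ))
      = {fun _ => m} := by
    ext b
    simp only [mem_filter, mem_Iic, mem_singleton]
    constructor
    · rintro ⟨hb, hs⟩
      have := (Finset.sum_eq_sum_iff_of_le (s := univ) (f := b) (g := fun _ => m)
        fun i _ => hb i).mp (by simpa using hs)
      exact funext fun i => this i (mem_univ i)
    · rintro rfl
      simp
  rw [this, Finset.sum_singleton]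

lemma layerSum_le {m r : ℕ} (hm : 1 ≤ m) (s : ℕ) (hs : s ≤ r * m) :
    layerSum (fun _ : Fin r => m) (r * m - s)
      ≤ layerBound m r s * realMultinomial (fun _ : Fin r => m) := by
  induction s with
  | zero => simp [layerBound, layerSum_top]
  | succ s ih =>
    obtain ⟨n, hn⟩ : ∃ n, n + 1 + s = r * m := ⟨r * m - (s + 1), by omega⟩
    have h1 : r * m - s = n + 1 := by omega
    have h2 : r * m - (s + 1) = n := by omega
    have ih := ih (by omega)
    have step := layerSum_le_layerSum_succ hn
    rw [h1] at ih
    rw [layerBound, Finset.prod_range_succ, ← layerBound, h1, h2]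
    have hpos : (0 : ℝ) < s + 1 := by positivity
    have hm' : (1 : ℝ) ≤ m := by exact_mod_cast hm
    have hmin : 0 ≤ min (m : ℝ) (1 + (m - 1) * s / (n + 1 : ℕ)) := by
      have : (0 : ℝ) ≤ m - 1 := by linarith
      positivity
    have := step.trans (mul_le_mul_of_nonneg_left ih hmin)
    rw [← mul_le_mul_iff_right₀ hpos]
    refine this.trans_eq ?_
    field_simp

lemma layerBound_nonneg {m : ℕ} (hm : 1 ≤ m) (r s : ℕ) : 0 ≤ layerBound m r s := by
  have : (0 : ℝ) ≤ m - 1 := by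
    have : (1 : ℝ) ≤ m := by exact_mod_cast hm
    linarith
  exact Finset.prod_nonneg fun t _ => by positivity

lemma layerBound_le {m : ℕ} (hm : 1 ≤ m) (r s : ℕ) :
    layerBound m r s ≤ (m : ℝ) ^ s / s.factorial := by
  have hm' : (0 : ℝ) ≤ m - 1 := by
    have : (1 : ℝ) ≤ m := by exact_mod_cast hm
    linarith
  have : (m : ℝ) ^ s / s.factorial = ∏ t ∈ range s, (m : ℝ) / (t + 1) := by
    rw [Finset.prod_div_distrib, Finset.prod_const, card_range, ← Finset.prod_range_add_one_eq_factorial]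
    push_cast
    rfl
  rw [this]
  refine Finset.prod_le_prod (fun t _ => by positivity) fun t _ => ?_
  gcongr
  exact min_le_left _ _

open Filter Topology in
lemma tendsto_layerBound {m : ℕ} (hm : 1 ≤ m) (s : ℕ) :
    Tendsto (fun r => layerBound m r s) atTop (𝓝 ((s.factorial : ℝ)⁻¹)) := by
  have hm' : (1 : ℝ) ≤ m := by exact_mod_cast hm
  have : ((s.factorial : ℝ)⁻¹) = ∏ t ∈ range s, min (m : ℝ) (1 + 0) / (t + 1) := by
    rw [Finset.prod_div_distrib, ← Finset.prod_range_add_one_eq_factorial]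
    push_cast
    simp [hm']
  rw [this]
  refine tendsto_finsetProd _ fun t _ => ?_
  refine (tendsto_const_nhds.min (tendsto_const_nhds.add ?_)).div_const _
  refine Tendsto.const_div_atTop ?_ _
  exact tendsto_natCast_atTop_atTop.comp ((tendsto_sub_atTop_nat t).comp
    (tendsto_id.atTop_mul_const' hm))

lemma boxSum_const_le {m : ℕ} (hm : 1 ≤ m) (r : ℕ) :
    boxSum (fun _ : Fin r => m)
      ≤ (∑' s, layerBound m r s) * realMultinomial (fun _ : Fin r => m) := by
  have hsplit : boxSum (fun _ : Fin r => m)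
      = ∑ n ∈ range (r * m + 1), layerSum (fun _ : Fin r => m) n := by
    refine (Finset.sum_fiberwise_of_maps_to (fun b hb => ?_) _).symm
    rw [mem_range, Nat.lt_succ_iff]
    calc ∑ i, b i ≤ ∑ _i : Fin r, m := Finset.sum_le_sum fun i _ => mem_Iic.mp hb i
      _ = r * m := by simp
  have hsummable : Summable (layerBound m r) :=
    Summable.of_nonneg_of_le (layerBound_nonneg hm r) (layerBound_le hm r)
      (Real.summable_pow_div_factorial m)
  rw [hsplit, ← Finset.sum_range_reflect]
  calc _ ≤ ∑ s ∈ range (r * m + 1), layerBound m r s * realMultinomial (fun _ : Fin r => m) := by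
        refine Finset.sum_le_sum fun s hs => ?_
        rw [Nat.add_sub_cancel]
        exact layerSum_le hm s (Nat.lt_succ_iff.mp (mem_range.mp hs))
    _ ≤ _ := by
        rw [← Finset.sum_mul]
        exact mul_le_mul_of_nonneg_right
          (hsummable.sum_le_tsum _ fun s _ => layerBound_nonneg hm r s)
          (realMultinomial_pos _).le

open Filter Topology in
lemma tendsto_tsum_layerBound {m : ℕ} (hm : 1 ≤ m) :
    Tendsto (fun r => ∑' s, layerBound m r s) atTop (𝓝 (Real.exp 1)) := by
  have he : Real.exp 1 = ∑' s : ℕ, ((s.factorial : ℝ)⁻¹) := by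
    rw [Real.exp_eq_exp_ℝ, NormedSpace.exp_eq_tsum_div]
    simp
  rw [he]
  refine tendsto_tsum_of_dominated_convergence (Real.summable_pow_div_factorial m)
    (tendsto_layerBound hm) (Eventually.of_forall fun r s => ?_)
  rw [Real.norm_of_nonneg (layerBound_nonneg hm r s)]
  exact layerBound_le hm r s

lemma realMultinomial_const (m r : ℕ) :
    realMultinomial (fun _ : Fin r => m) = ((r * m).factorial : ℝ) / (m.factorial : ℝ) ^ r := by
  simp [realMultinomial]

open Filter Topology in
lemma tendsto_inv_realMultinomial_const {m : ℕ} (hm : 1 ≤ m) :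
    Tendsto (fun r => (realMultinomial (fun _ : Fin r => m))⁻¹) atTop (𝓝 0) := by
  have h := (FloorSemiring.tendsto_pow_div_factorial_atTop (m.factorial : ℝ)).comp
    (tendsto_id.atTop_mul_const' hm : Tendsto (fun r : ℕ => r * m) atTop atTop)
  refine squeeze_zero (fun r => (inv_pos.mpr (realMultinomial_pos _)).le) (fun r => ?_) h
  rw [realMultinomial_const, inv_div]
  simp only [Function.comp_apply]
  gcongr
  · exact_mod_cast Nat.factorial_pos m
  · exact Nat.le_mul_of_pos_right r hm

theorem stmt_16 (k : ℕ) (hk : 4 ≤ k) :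
    ∀ ε : ℝ, 0 < ε → ∀ᶠ r : ℕ in Filter.atTop,
      (ramseyNumber r (fun _ => k) : ℝ) ≤
        ((3 + Real.exp 1) / 2 + ε) * ((r * (k - 2)).factorial : ℝ) /
          ((k - 2).factorial : ℝ) ^ r := by
  intro ε hε
  obtain ⟨m, rfl⟩ : ∃ m, k = m + 2 := ⟨k - 2, by omega⟩
  have hm : 1 ≤ m := by omega
  have hlim := (tendsto_tsum_layerBound hm).add (tendsto_inv_realMultinomial_const hm)
  have he : Real.exp 1 + 0 < (3 + Real.exp 1) / 2 + ε := by
    have := Real.exp_one_lt_d9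
    linarith
  filter_upwards [hlim.eventually_lt_const he] with r hr
  rw [Nat.add_sub_cancel, mul_div_assoc, ← realMultinomial_const]
  have hM := realMultinomial_pos (fun _ : Fin r => m)
  calc (ramseyNumber r (fun _ => m + 2) : ℝ) ≤ boxSum (fun _ : Fin r => m) + 1 :=
        ramseyNumber_le fun _ => m
    _ ≤ (∑' s, layerBound m r s) * realMultinomial (fun _ : Fin r => m) + 1 := by
        gcongr
        exact boxSum_const_le hm r
    _ = (∑' s, layerBound m r s + (realMultinomial (fun _ : Fin r => m))⁻¹)
          * realMultinomial (fun _ : Fin r => m) := by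
        rw [add_mul, inv_mul_cancel₀ hM.ne']
    _ ≤ _ := mul_le_mul_of_nonneg_right hr.le hM.le
end

section
/- For every integer r ≥ 2, the diagonal Ramsey number satisfies R_r(4) ≤ ((2r)!/2^r) · (10/3 − 2(r−2)/((2r−1)(2r−3))). -/
/-- The value of the neighbourhood recursion for Ramsey numbers with `a` colors of target
clique size `4` and `b` colors of target clique size `3`. -/
def ramseyRec : ℕ → ℕ → ℕ
  | 0, 0 => 1
  | 0, b + 1 => 1 + (b + 1) * ramseyRec 0 b
  | a + 1, 0 => 1 + (a + 1) * ramseyRec a 1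
  | a + 1, b + 1 => 1 + (a + 1) * ramseyRec a (b + 2) + (b + 1) * ramseyRec (a + 1) b
termination_by a b => (a, b)

theorem ramseyRec_eq (a b : ℕ) :
    ramseyRec a b = 1 + a * ramseyRec (a - 1) (b + 1) + b * ramseyRec a (b - 1) := by
  rcases a with _ | a <;> rcases b with _ | b <;> rw [ramseyRec] <;> simp

open Finset in
/-- If one neighbourhood of `v` contains a monochromatic clique for the targets in which the
target of that neighbourhood's color is lowered by one, then adding `v` restores the target. -/
theorem exists_mono_of_neighbourhood {α κ : Type*} [DecidableEq α] [DecidableEq κ]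
    (c : Sym2 α → κ) (k : κ → ℕ) {V W : Finset α} {v : α} {i : κ} {m : ℕ} (hv : v ∈ V)
    (hW : ∀ u ∈ W, u ∈ V ∧ u ≠ v ∧ c s(v, u) = i) (hm : k i = m + 1)
    (h : ∃ j, ∃ S ⊆ W, #S = Function.update k i m j ∧
      ∀ x ∈ S, ∀ y ∈ S, x ≠ y → c s(x, y) = j) :
    ∃ j, ∃ S ⊆ V, #S = k j ∧ ∀ x ∈ S, ∀ y ∈ S, x ≠ y → c s(x, y) = j := by
  obtain ⟨j, S, hSW, hS, hc⟩ := h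
  by_cases hj : j = i
  · subst hj
    have hvS : v ∉ S := fun hvS => (hW v (hSW hvS)).2.1 rfl
    refine ⟨j, insert v S, ?_, ?_, ?_⟩
    · exact insert_subset hv fun u hu => (hW u (hSW hu)).1
    · rw [card_insert_of_notMem hvS, hS, hm, Function.update_self]
    · intro x hx y hy hxy
      rcases mem_insert.1 hx with rfl | hxS <;> rcases mem_insert.1 hy with rfl | hyS
      · exact absurd rfl hxy
      · exact (hW y (hSW hyS)).2.2
      · rw [Sym2.eq_swap]
        exact (hW x (hSW hxS)).2.2
      · exact hc x hxS y hyS hxy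
  · exact ⟨j, S, fun u hu => (hW u (hSW hu)).1, by rw [hS, Function.update_of_ne hj], hc⟩

open Finset in
theorem exists_mono_of_ramseyRec_lt {α κ : Type*} [DecidableEq α] [Fintype κ] [DecidableEq κ]
    (c : Sym2 α → κ) (V : Finset α) (k : κ → ℕ) (hk : ∀ i, k i = 2 ∨ k i = 3 ∨ k i = 4)
    (hV : ramseyRec #{i | k i = 4} #{i | k i = 3} < #V) :
    ∃ i, ∃ S ⊆ V, #S = k i ∧ ∀ x ∈ S, ∀ y ∈ S, x ≠ y → c s(x, y) = i := by
  induction V using Finset.strongInduction generalizing k with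
  | H V ih =>
  obtain ⟨v, hv⟩ : V.Nonempty := card_pos.1 (by omega)
  set N : κ → Finset α := fun i => {u ∈ V.erase v | c s(v, u) = i} with hN
  have hNV : ∀ i, ∀ u ∈ N i, u ∈ V ∧ u ≠ v ∧ c s(v, u) = i := by
    intro i u hu
    simp only [hN, mem_filter, mem_erase] at hu
    tauto
  have hNss : ∀ i, N i ⊂ V := fun i =>
    (filter_subset _ _).trans_ssubset (erase_ssubset hv)
  by_contra hcon
  have h2 : ∀ i, k i = 2 → #(N i) = 0 := by
    intro i hi
    by_contra hne
    obtain ⟨u, hu⟩ := card_pos.1 (Nat.pos_of_ne_zero hne)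
    refine hcon (exists_mono_of_neighbourhood c k (m := 1) hv (hNV i) hi
      ⟨i, {u}, singleton_subset_iff.2 hu, by simp, ?_⟩)
    intro x hx y hy hxy
    rw [mem_singleton] at hx hy
    exact absurd (hx.trans hy.symm) hxy
  have h3 : ∀ i, k i = 3 →
      #(N i) ≤ ramseyRec #{i | k i = 4} (#{i | k i = 3} - 1) := by
    intro i hi
    by_contra! hlt
    refine hcon (exists_mono_of_neighbourhood c k (m := 2) hv (hNV i) hi
      (ih (N i) (hNss i) (Function.update k i 2) ?_ ?_))
    · intro j
      by_cases hj : j = i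
      · simp [hj]
      · simpa [Function.update_of_ne hj] using hk j
    · have e4 : ({j | Function.update k i 2 j = 4} : Finset κ) =
          ({j | k j = 4} : Finset κ) := by
        ext j
        by_cases hj : j = i
        · simp [hj, hi]
        · simp [Function.update_of_ne hj]
      have e3 : ({j | Function.update k i 2 j = 3} : Finset κ) =
          ({j | k j = 3} : Finset κ).erase i := by
        ext j
        by_cases hj : j = i
        · simp [hj]
        · simp [hj]
      rw [e4, e3, card_erase_of_mem (by simpa using hi)]
      exact hlt
  have h4 : ∀ i, k i = 4 →
      #(N i) ≤ ramseyRec (#{i | k i = 4} - 1) (#{i | k i = 3} + 1) := by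
    intro i hi
    by_contra! hlt
    refine hcon (exists_mono_of_neighbourhood c k (m := 3) hv (hNV i) hi
      (ih (N i) (hNss i) (Function.update k i 3) ?_ ?_))
    · intro j
      by_cases hj : j = i
      · simp [hj]
      · simpa [Function.update_of_ne hj] using hk j
    · have e4 : ({j | Function.update k i 3 j = 4} : Finset κ) =
          ({j | k j = 4} : Finset κ).erase i := by
        ext j
        by_cases hj : j = i
        · simp [hj]
        · simp [hj]
      have e3 : ({j | Function.update k i 3 j = 3} : Finset κ) =
          insert i ({j | k j = 3} : Finset κ) := by
        ext j
        by_cases hj : j = i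
        · simp [hj]
        · simp [hj]
      rw [e4, e3, card_erase_of_mem (by simpa using hi),
        card_insert_of_notMem (by simp [hi])]
      exact hlt
  have hsum : #(V.erase v) = ∑ i, #(N i) :=
    card_eq_sum_card_fiberwise fun _ _ => mem_coe.2 (mem_univ _)
  have hle : ∑ i, #(N i) ≤
      #{i | k i = 4} * ramseyRec (#{i | k i = 4} - 1) (#{i | k i = 3} + 1) +
        #{i | k i = 3} * ramseyRec #{i | k i = 4} (#{i | k i = 3} - 1) := by
    rw [← smul_eq_mul, ← smul_eq_mul, ← sum_const, ← sum_const, sum_filter, sum_filter,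
      ← sum_add_distrib]
    refine sum_le_sum fun i _ => ?_
    rcases hk i with hi | hi | hi
    · simp [hi, h2 i hi]
    · simpa [hi] using h3 i hi
    · simpa [hi] using h4 i hi
  rw [card_erase_of_mem hv] at hsum
  rw [ramseyRec_eq] at hV
  omega

theorem ramseyNumber_four_le (r : ℕ) :
    ramseyNumber r (fun _ => 4) ≤ ramseyRec r 0 + 1 := by
  refine Nat.sInf_le fun C => ?_
  obtain ⟨i, S, -, hS, hc⟩ := exists_mono_of_ramseyRec_lt C Finset.univ (fun _ => 4)
    (fun _ => by simp) (by simp)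
  exact ⟨i, S, hS, hc⟩

/-- A solution of the homogeneous recursion
`B a b = a * B (a - 1) (b + 1) + b * B a (b - 1)` on `3 ≤ 2 * a + b`, which dominates
`ramseyRec + 1` as soon as at least two colors are present. -/
noncomputable def ramseyBound (a b : ℕ) : ℝ :=
  ((2 * a + b).factorial : ℝ) / 2 ^ a *
    (3 + 2 * (a : ℝ) / ((2 * (a : ℝ) + b) * (2 * (a : ℝ) + b - 1)))

theorem mul_ramseyBound_lower_four {a b m : ℕ} (h : 2 * a + b = m + 3) :
    (a : ℝ) * ramseyBound (a - 1) (b + 1) =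
      2 * a * ((m + 2).factorial : ℝ) / 2 ^ a *
        (3 + 2 * ((a : ℝ) - 1) / (((m : ℝ) + 2) * ((m : ℝ) + 1))) := by
  rcases a with _ | a
  · simp
  · have e : 2 * a + (b + 1) = m + 2 := by omega
    have e' : 2 * (a : ℝ) + ((b + 1 : ℕ) : ℝ) = (m : ℝ) + 2 := mod_cast e
    rw [ramseyBound, Nat.add_sub_cancel, e, e', pow_succ]
    push_cast
    rw [show (m : ℝ) + 2 - 1 = m + 1 by ring, add_sub_cancel_right]
    field_simp

theorem mul_ramseyBound_lower_three {a b m : ℕ} (h : 2 * a + b = m + 3) :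
    (b : ℝ) * ramseyBound a (b - 1) =
      b * ((m + 2).factorial : ℝ) / 2 ^ a *
        (3 + 2 * (a : ℝ) / (((m : ℝ) + 2) * ((m : ℝ) + 1))) := by
  rcases b with _ | b
  · simp
  · have e : 2 * a + b = m + 2 := by omega
    have e' : 2 * (a : ℝ) + (b : ℝ) = (m : ℝ) + 2 := mod_cast e
    rw [ramseyBound, Nat.add_sub_cancel, e, e', show (m : ℝ) + 2 - 1 = m + 1 by ring]
    ring

theorem ramseyBound_eq {a b : ℕ} (h : 3 ≤ 2 * a + b) :
    ramseyBound a b = a * ramseyBound (a - 1) (b + 1) + b * ramseyBound a (b - 1) := by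
  obtain ⟨m, hm⟩ := Nat.exists_eq_add_of_le' h
  have hb : (b : ℝ) = m + 3 - 2 * a := by
    have : 2 * (a : ℝ) + b = m + 3 := mod_cast hm
    linarith
  rw [mul_ramseyBound_lower_four hm, mul_ramseyBound_lower_three hm, ramseyBound, hm,
    Nat.factorial_succ, hb]
  push_cast
  rw [show 2 * (a : ℝ) + (m + 3 - 2 * a) = m + 3 by ring,
    show (m : ℝ) + 3 - 1 = m + 2 by ring]
  field_simp
  ring

theorem ramseyRec_add_one_le (a b : ℕ) (h : 2 ≤ a + b) :
    (ramseyRec a b : ℝ) + 1 ≤ ramseyBound a b := by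
  obtain ⟨n, hn⟩ : ∃ n, 2 * a + b = n := ⟨_, rfl⟩
  induction n using Nat.strong_induction_on generalizing a b with
  | _ n ih =>
  obtain h2 | h3 := h.eq_or_lt
  · obtain ⟨rfl, rfl⟩ | ⟨rfl, rfl⟩ | ⟨rfl, rfl⟩ :
        (a = 0 ∧ b = 2) ∨ (a = 1 ∧ b = 1) ∨ (a = 2 ∧ b = 0) := by omega
    all_goals norm_num [ramseyRec, ramseyBound, Nat.factorial]
  · have hfour : (a : ℝ) * (ramseyRec (a - 1) (b + 1) + 1) ≤
        a * ramseyBound (a - 1) (b + 1) := by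
      rcases a.eq_zero_or_pos with rfl | ha
      · simp
      · exact mul_le_mul_of_nonneg_left (ih (n - 1) (by omega) _ _ (by omega) (by omega))
          a.cast_nonneg
    have hthree : (b : ℝ) * (ramseyRec a (b - 1) + 1) ≤ b * ramseyBound a (b - 1) := by
      rcases b.eq_zero_or_pos with rfl | hb
      · simp
      · exact mul_le_mul_of_nonneg_left (ih (n - 1) (by omega) _ _ (by omega) (by omega))
          b.cast_nonneg
    have hab : (2 : ℝ) ≤ a + b := mod_cast h
    rw [ramseyRec_eq, ramseyBound_eq (by omega)]
    push_cast
    linarith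

theorem stmt_17 (r : ℕ) (hr : 2 ≤ r) :
    (ramseyNumber r (fun _ => 4) : ℝ) ≤
      ((2 * r).factorial : ℝ) / 2 ^ r *
        (10 / 3 - 2 * ((r : ℝ) - 2) / ((2 * (r : ℝ) - 1) * (2 * (r : ℝ) - 3))) := by
  have hr' : (2 : ℝ) ≤ r := mod_cast hr
  have hprod : 0 ≤ ((r : ℝ) - 2) * (r - 3) := by
    rcases hr.eq_or_lt with rfl | h3
    · norm_num
    · have : (3 : ℝ) ≤ r := mod_cast h3
      exact mul_nonneg (by linarith) (by linarith)
  have hle : (ramseyNumber r (fun _ => 4) : ℝ) ≤ ramseyRec r 0 + 1 :=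
    mod_cast ramseyNumber_four_le r
  refine (hle.trans (ramseyRec_add_one_le r 0 hr)).trans ?_
  rw [ramseyBound]
  refine mul_le_mul_of_nonneg_left ?_ (by positivity)
  have h1 : (0 : ℝ) < 2 * r - 1 := by linarith
  have h3 : (0 : ℝ) < 2 * r - 3 := by linarith
  have key : 10 / 3 - 2 * ((r : ℝ) - 2) / ((2 * r - 1) * (2 * r - 3)) -
      (3 + 2 * (r : ℝ) / (2 * r * (2 * r - 1))) =
      4 * ((r - 2) * (r - 3)) / (3 * ((2 * r - 1) * (2 * r - 3))) := by
    have h0 : (r : ℝ) ≠ 0 := by linarith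
    field_simp
    ring
  have : 0 ≤ 4 * (((r : ℝ) - 2) * (r - 3)) / (3 * ((2 * r - 1) * (2 * r - 3))) := by
    positivity
  rw [Nat.cast_zero, add_zero]
  linarith
end

section
/- Let f(x,y) = (x+y)(x+y−1)/(xy) for real x, y > 0. Then: (a) for all real x, y > 1, f(x−1,y) ≤ f(x,y) if and only if x ≥ y; and (b) for all integers r ≥ 2, n_1, n_2 ≥ 2 and n_3, …, n_r ≥ 0, one has f(n_1−1,n_2) · multinomial(n_1+⋯+n_r−3; n_1−2, n_2−1, n_3,…,n_r) + f(n_1,n_2−1) · multinomial(n_1+⋯+n_r−3; n_1−1, n_2−2, n_3,…,n_r) = f(n_1,n_2) · (multinomial(n_1+⋯+n_r−3; n_1−2, n_2−1, n_3,…,n_r) + multinomial(n_1+⋯+n_r−3; n_1−1, n_2−2, n_3,…,n_r)). -/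
/-- The auxiliary function `f(x, y) = (x + y)(x + y - 1)/(xy)`. -/
noncomputable def fAux (x y : ℝ) : ℝ := (x + y) * (x + y - 1) / (x * y)

/-- Lowering the first or the second of two positive entries gives proportional multinomials. -/
lemma multinomial_exchange {k : ℕ} (a b : ℕ) (g : Fin k → ℕ) :
    Nat.multinomial Finset.univ (Fin.cons a (Fin.cons (b + 1) g : Fin (k + 1) → ℕ) : Fin (k + 2) → ℕ) *
        (b + 1) =
      Nat.multinomial Finset.univ
        (Fin.cons (a + 1) (Fin.cons b g : Fin (k + 1) → ℕ) : Fin (k + 2) → ℕ) * (a + 1) := by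
  have h₁ := Nat.multinomial_spec Finset.univ
    (Fin.cons a (Fin.cons (b + 1) g : Fin (k + 1) → ℕ) : Fin (k + 2) → ℕ)
  have h₂ := Nat.multinomial_spec Finset.univ
    (Fin.cons (a + 1) (Fin.cons b g : Fin (k + 1) → ℕ) : Fin (k + 2) → ℕ)
  simp only [Fin.prod_univ_succ, Fin.sum_univ_succ, Fin.cons_zero, Fin.cons_succ,
    Nat.factorial_succ] at h₁ h₂
  rw [show a + 1 + (b + ∑ i, g i) = a + (b + 1 + ∑ i, g i) by ring, ← h₁] at h₂
  have hpos : 0 < a.factorial * (b.factorial * ∏ i, (g i).factorial) := by positivity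
  apply Nat.eq_of_mul_eq_mul_left hpos
  linear_combination -h₂

/-- The weighted identity for `fAux`, given the ratio of the two weights. -/
lemma fAux_weighted_sum {x y M N : ℝ} (hx : 1 < x) (hy : 1 < y)
    (h : M * (y - 1) = N * (x - 1)) :
    fAux (x - 1) y * M + fAux x (y - 1) * N = fAux x y * (M + N) := by
  have hx₁ : x - 1 ≠ 0 := by linarith
  have hy₁ : y - 1 ≠ 0 := by linarith
  have hx₀ : x ≠ 0 := by linarith
  have hy₀ : y ≠ 0 := by linarith
  obtain rfl : M = N * (x - 1) / (y - 1) := by rw [← h]; field_simp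
  unfold fAux
  field_simp
  ring

/-- Lowering the first argument of `fAux` by one. -/
lemma fAux_sub_one_le_iff {x y : ℝ} (hx : 1 < x) (hy : 1 < y) :
    fAux (x - 1) y ≤ fAux x y ↔ y ≤ x := by
  have hx₁ : 0 < x - 1 := by linarith
  have hx₀ : 0 < x := by linarith
  have hy₀ : 0 < y := by linarith
  have hc : 0 < (x + y - 1) / (x * y * (x - 1)) := by
    have : 0 < x + y - 1 := by linarith
    positivity
  have key : fAux x y - fAux (x - 1) y = (x + y - 1) / (x * y * (x - 1)) * (x - y) := by
    unfold fAux
    field_simp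
    ring
  rw [← sub_nonneg, key, mul_nonneg_iff_of_pos_left hc, sub_nonneg]

theorem stmt_18 :
    (∀ x y : ℝ, 1 < x → 1 < y → (fAux (x - 1) y ≤ fAux x y ↔ y ≤ x)) ∧
    (∀ (r : ℕ) (hr : 2 ≤ r) (n : Fin r → ℕ),
      2 ≤ n ⟨0, by omega⟩ → 2 ≤ n ⟨1, by omega⟩ →
      fAux ((n ⟨0, by omega⟩ : ℝ) - 1) (n ⟨1, by omega⟩ : ℝ) *
          (Nat.multinomial Finset.univ
            (fun l : Fin r =>
              if (l : ℕ) = 0 then n l - 2 else if (l : ℕ) = 1 then n l - 1 else n l) : ℝ) +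
        fAux (n ⟨0, by omega⟩ : ℝ) ((n ⟨1, by omega⟩ : ℝ) - 1) *
          (Nat.multinomial Finset.univ
            (fun l : Fin r =>
              if (l : ℕ) = 0 then n l - 1 else if (l : ℕ) = 1 then n l - 2 else n l) : ℝ) =
      fAux (n ⟨0, by omega⟩ : ℝ) (n ⟨1, by omega⟩ : ℝ) *
          ((Nat.multinomial Finset.univ
            (fun l : Fin r =>
              if (l : ℕ) = 0 then n l - 2 else if (l : ℕ) = 1 then n l - 1 else n l) : ℝ) +
           (Nat.multinomial Finset.univ
            (fun l : Fin r =>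
              if (l : ℕ) = 0 then n l - 1 else if (l : ℕ) = 1 then n l - 2 else n l) : ℝ))) := by
  refine ⟨fun x y hx hy => fAux_sub_one_le_iff hx hy, fun r hr n h₀ h₁ => ?_⟩
  obtain ⟨k, rfl⟩ := Nat.exists_eq_add_of_le' hr
  apply fAux_weighted_sum
  · exact_mod_cast h₀
  · exact_mod_cast h₁
  obtain ⟨a, ha⟩ := Nat.exists_eq_add_of_le' h₀
  obtain ⟨b, hb⟩ := Nat.exists_eq_add_of_le' h₁
  have h := multinomial_exchange a b fun i : Fin k => n i.succ.succ
  convert congrArg (Nat.cast (R := ℝ)) h using 1 <;> push_cast <;> congr 1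
  · congr 2
    funext l
    refine Fin.cases ?_ (fun l => Fin.cases ?_ (fun l => ?_) l) l
    · simp [show n 0 = a + 2 from ha]
    · simp [show n 1 = b + 2 from hb]
    · simp
  · rw [hb]; push_cast; ring
  · congr 2
    funext l
    refine Fin.cases ?_ (fun l => Fin.cases ?_ (fun l => ?_) l) l
    · simp [show n 0 = a + 2 from ha]
    · simp [show n 1 = b + 2 from hb]
    · simp
  · rw [ha]; push_cast; ring
end

section
/- Fix an integer k ≥ 4 and a real c > 0. If the limsup as r → ∞ of R_r(3)/r! is at most 3 − c, then the limsup as r → ∞ of R_r(k) · ((k−2)!)^r / (r(k−2))! is at most 3 − c/2; equivalently, if R_r(3) ≤ (3−c)·r!·(1+o(1)) then R_r(k) ≤ (3 − c/2) · (r(k−2))!/((k−2)!)^r · (1 + o(1)) as r → ∞. -/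
open Finset Filter

/-- The coloring `C` has no clique on `a i + 2` vertices in color `i` inside `S`, for any `i`. -/
def AvoidsCliques {V ι : Type*} (C : Sym2 V → ι) (a : ι → ℕ) (S : Finset V) : Prop :=
  ∀ i, ∀ T ⊆ S, (∀ x ∈ T, ∀ y ∈ T, x ≠ y → C s(x, y) = i) → T.card < a i + 2

section Avoiding

variable {V ι : Type*} [DecidableEq V] {C : Sym2 V → ι} {a : ι → ℕ}
  {S : Finset V}

/-- In a coloring avoiding cliques, an edge inside `S` has a color `i` with `a i ≠ 0`. -/
lemma AvoidsCliques.color_ne_zero (h : AvoidsCliques C a S) {x y : V} (hx : x ∈ S) (hy : y ∈ S)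
    (hxy : x ≠ y) : a (C s(x, y)) ≠ 0 := by
  intro h0
  have := h (C s(x, y)) {x, y} (by simp [insert_subset_iff, hx, hy]) (by
    intro u hu w hw huw
    simp only [mem_insert, mem_singleton] at hu hw
    rcases hu with rfl | rfl <;> rcases hw with rfl | rfl <;> simp_all [Sym2.eq_swap])
  rw [card_pair hxy, h0] at this
  omega

lemma prod_factorial_le_pow_sum [Fintype ι] {K : ℕ} (haK : ∀ i, a i ≤ K) :
    ∏ i, (a i).factorial ≤ K ^ ∑ i, a i := by
  rw [← prod_pow_eq_pow_sum]
  exact prod_le_prod' fun i _ => (Nat.factorial_le_pow _).trans (Nat.pow_le_pow_left (haK i) _)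

variable [DecidableEq ι]

/-- The neighborhood argument: one vertex splits `S` into color neighborhoods. -/
lemma AvoidsCliques.exists_neighborhoods [Fintype ι] (h : AvoidsCliques C a S) :
    ∃ N : ι → Finset V, S.card ≤ 1 + ∑ i, (N i).card ∧ (∀ i, a i = 0 → N i = ∅) ∧
      ∀ i, a i ≠ 0 → AvoidsCliques C (Function.update a i (a i - 1)) (N i) := by
  rcases S.eq_empty_or_nonempty with rfl | ⟨v, hv⟩
  · refine ⟨fun _ => ∅, by simp, by simp, fun i _ j T hT _ => ?_⟩
    rw [subset_empty.mp hT]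
    simp
  refine ⟨fun i => (S.erase v).filter fun w => C s(v, w) = i, ?_, ?_, ?_⟩
  · rw [← card_erase_add_one hv, add_comm]
    gcongr
    exact (card_eq_sum_card_fiberwise (t := univ) (fun _ _ => by simp)).le
  · intro i hi
    refine filter_eq_empty_iff.mpr fun w hw hc => ?_
    rw [mem_erase] at hw
    exact h.color_ne_zero hv hw.2 hw.1.symm (hc ▸ hi)
  · intro i hi j T hT hmono
    have hTS : T ⊆ S := fun x hx => mem_of_mem_erase (mem_of_mem_filter x (hT hx))
    have hvT : v ∉ T := fun hx => by simpa using hT hx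
    by_cases hji : j = i
    · subst hji
      have hc : ∀ w ∈ T, C s(v, w) = j := fun w hw => (mem_filter.mp (hT hw)).2
      have := h j (insert v T) (insert_subset hv hTS) (by
        intro x hx y hy hxy
        rcases mem_insert.mp hx with rfl | hxT <;> rcases mem_insert.mp hy with rfl | hyT
        · exact absurd rfl hxy
        · exact hc y hyT
        · rw [Sym2.eq_swap]; exact hc x hxT
        · exact hmono x hxT y hyT hxy)
      rw [card_insert_of_notMem hvT] at this
      rw [Function.update_self]
      omega
    · rw [Function.update_of_ne hji]
      exact h j T hTS hmono

lemma sum_update_pred_add_one [Fintype ι] {i : ι} (hi : a i ≠ 0) :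
    ∑ j, Function.update a i (a i - 1) j + 1 = ∑ j, a j := by
  rw [sum_update_of_mem (mem_univ i), ← add_sum_erase univ a (mem_univ i),
    sdiff_singleton_eq_erase]
  omega

lemma prod_factorial_eq_mul_prod_update [Fintype ι] {i : ι} (hi : a i ≠ 0) :
    ∏ j, (a j).factorial = a i * ∏ j, (Function.update a i (a i - 1) j).factorial := by
  rw [← mul_prod_erase univ _ (mem_univ i),
    ← mul_prod_erase univ (fun j => (Function.update a i (a i - 1) j).factorial) (mem_univ i),
    Function.update_self, ← mul_assoc, Nat.mul_factorial_pred hi]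
  congr 1
  refine prod_congr rfl fun j hj => ?_
  rw [Function.update_of_ne (ne_of_mem_erase hj)]

lemma sum_mul_pred_update [Fintype ι] {i : ι} (hi : a i ≠ 0) :
    ∑ j, (Function.update a i (a i - 1) j : ℝ) * ((Function.update a i (a i - 1) j : ℝ) - 1) =
      ∑ j, (a j : ℝ) * (a j - 1) - 2 * (a i - 1) := by
  rw [← add_sum_erase univ _ (mem_univ i),
    ← add_sum_erase univ (fun j => (a j : ℝ) * (a j - 1)) (mem_univ i), Function.update_self,
    sum_congr rfl fun j hj => by rw [Function.update_of_ne (ne_of_mem_erase hj)],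
    Nat.cast_pred (Nat.pos_of_ne_zero hi)]
  ring

lemma AvoidsCliques.card_le_factorial [Fintype ι] (h : AvoidsCliques C a S) :
    S.card ≤ (∑ i, a i + 1).factorial := by
  induction hn : ∑ i, a i generalizing a S with
  | zero =>
    obtain ⟨N, hN, hN0, -⟩ := h.exists_neighborhoods
    have h0 : ∀ i, a i = 0 := by simpa using hn
    simpa [hN0 _ (h0 _)] using hN
  | succ n ih =>
    obtain ⟨N, hN, hN0, hN1⟩ := h.exists_neighborhoods
    have hle : ∑ i, (N i).card ≤ ∑ i, a i * (n + 1).factorial := by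
      refine sum_le_sum fun i _ => ?_
      by_cases hi : a i = 0
      · simp [hN0 i hi]
      · have := sum_update_pred_add_one hi
        exact (ih (hN1 i hi) (by omega)).trans
          (Nat.le_mul_of_pos_left _ (Nat.pos_of_ne_zero hi))
    rw [← sum_mul, hn] at hle
    have := Nat.factorial_pos (n + 1)
    rw [Nat.factorial_succ (n + 1)]
    linarith

lemma AvoidsCliques.card_mul_prod_factorial_le [Fintype ι] {K s : ℕ} {A B : ℝ} (hs : 2 ≤ s)
    (hbase : ∀ (a : ι → ℕ) (S : Finset V), (∀ i, a i ≤ K) → ∑ i, a i = s → AvoidsCliques C a S →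
      (S.card : ℝ) * ∏ i, ((a i).factorial : ℝ) ≤
        s.factorial * A + B * (s - 2).factorial * ∑ i, (a i : ℝ) * (a i - 1))
    {n : ℕ} (hn : s ≤ n) (haK : ∀ i, a i ≤ K) (ha : ∑ i, a i = n) (h : AvoidsCliques C a S) :
    (S.card : ℝ) * ∏ i, ((a i).factorial : ℝ) ≤
      n.factorial * (A + (∑ m ∈ range (n + 1), (K : ℝ) ^ m / m.factorial -
        ∑ m ∈ range (s + 1), (K : ℝ) ^ m / m.factorial)) +
      B * (n - 2).factorial * ∑ i, (a i : ℝ) * (a i - 1) := by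
  induction n, hn using Nat.le_induction generalizing a S with
  | base => simpa using hbase a S haK ha h
  | succ n hn ih =>
    obtain ⟨N, hN, hN0, hN1⟩ := h.exists_neighborhoods
    set E : ℝ := A + (∑ m ∈ range (n + 1), (K : ℝ) ^ m / m.factorial -
        ∑ m ∈ range (s + 1), (K : ℝ) ^ m / m.factorial) with hE
    set Q : ℝ := ∑ i, (a i : ℝ) * (a i - 1) with hQ
    have hterm : ∀ i, ((N i).card : ℝ) * ∏ j, ((a j).factorial : ℝ) ≤
        a i * (n.factorial * E + B * (n - 2).factorial * (Q - 2 * (a i - 1))) := by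
      intro i
      by_cases hi : a i = 0
      · simp [hN0 i hi, hi]
      have hsum := sum_update_pred_add_one hi
      have hK : ∀ j, Function.update a i (a i - 1) j ≤ K := by
        intro j
        by_cases hji : j = i
        · subst hji
          rw [Function.update_self]
          exact (Nat.sub_le _ _).trans (haK j)
        · rw [Function.update_of_ne hji]
          exact haK j
      have hi' := ih hK (by omega) (hN1 i hi)
      rw [sum_mul_pred_update hi] at hi'
      have hp : ∏ j, ((a j).factorial : ℝ) =
          a i * ∏ j, ((Function.update a i (a i - 1) j).factorial : ℝ) := by
        exact_mod_cast prod_factorial_eq_mul_prod_update hi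
      rw [hp, mul_left_comm]
      exact mul_le_mul_of_nonneg_left hi' (Nat.cast_nonneg _)
    have hna : ∑ i, (a i : ℝ) = n + 1 := by exact_mod_cast ha
    have hsumle : (∑ i, ((N i).card : ℝ)) * ∏ j, ((a j).factorial : ℝ) ≤
        (n + 1) * n.factorial * E + B * (n - 2).factorial * ((n - 1) * Q) := by
      rw [sum_mul]
      refine (sum_le_sum fun i _ => hterm i).trans_eq ?_
      have : ∀ i, (a i : ℝ) * (n.factorial * E + B * (n - 2).factorial * (Q - 2 * (a i - 1))) =
          a i * (n.factorial * E + B * (n - 2).factorial * Q) -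
            2 * (B * (n - 2).factorial) * (a i * (a i - 1)) := fun i => by ring
      rw [sum_congr rfl fun i _ => this i, sum_sub_distrib, ← sum_mul, ← mul_sum, hna, ← hQ]
      ring
    have hNr : (S.card : ℝ) ≤ 1 + ∑ i, ((N i).card : ℝ) := by exact_mod_cast hN
    have hprod : ∏ j, ((a j).factorial : ℝ) ≤ (K : ℝ) ^ (n + 1) := by
      rw [← ha]; exact_mod_cast prod_factorial_le_pow_sum haK
    have hprod0 : 0 ≤ ∏ j, ((a j).factorial : ℝ) := by positivity
    have hfac : ((n + 1 - 2).factorial : ℝ) = (n - 1) * (n - 2).factorial := by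
      obtain ⟨m, rfl⟩ : ∃ m, n = m + 2 := ⟨n - 2, by omega⟩
      rw [show m + 2 + 1 - 2 = m + 1 by omega, show m + 2 - 2 = m by omega, Nat.factorial_succ]
      push_cast; ring
    have hfac' : ((n + 1).factorial : ℝ) = (n + 1) * n.factorial := by
      rw [Nat.factorial_succ]; push_cast; ring
    rw [sum_range_succ _ (n + 1), hfac]
    have hpos : ((n + 1).factorial : ℝ) ≠ 0 := by positivity
    have hexp : ((n + 1).factorial : ℝ) *
        (A + (∑ m ∈ range (n + 1), (K : ℝ) ^ m / m.factorial + (K : ℝ) ^ (n + 1) /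
          (n + 1).factorial - ∑ m ∈ range (s + 1), (K : ℝ) ^ m / m.factorial)) =
        (n + 1) * n.factorial * E + (K : ℝ) ^ (n + 1) := by
      rw [← hfac', hE]; field_simp; ring
    rw [hexp]
    have := mul_le_mul_of_nonneg_right hNr hprod0
    linarith

end Avoiding

lemma AvoidsCliques.of_not_ramseyProp {N r : ℕ} {a : Fin r → ℕ} {C : Sym2 (Fin N) → Fin r}
    (hC : ¬ ∃ i, MonochromaticClique C i (a i + 2)) : AvoidsCliques C a univ := by
  intro i T _ hT
  by_contra! hcard
  obtain ⟨U, hUT, hU⟩ := exists_subset_card_eq hcard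
  exact hC ⟨i, U, hU, fun x hx y hy => hT x (hUT hx) y (hUT hy)⟩

lemma ramseyProp_ramseyNumber {r : ℕ} (a : Fin r → ℕ) :
    RamseyProp (ramseyNumber r fun i => a i + 2) r fun i => a i + 2 := by
  refine Nat.sInf_mem (s := {N | RamseyProp N r fun i => a i + 2})
    ⟨(∑ i, a i + 1).factorial + 1, fun C => ?_⟩
  by_contra hC
  have := (AvoidsCliques.of_not_ramseyProp hC).card_le_factorial
  simp at this

/-- If all real sizes of clique-avoiding colorings are at most `X`, then the Ramsey number is at
most `X + 1`. -/
lemma ramseyNumber_le_add_one {r : ℕ} {a : Fin r → ℕ} {X : ℝ} (hX : 0 ≤ X)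
    (h : ∀ (N : ℕ) (C : Sym2 (Fin N) → Fin r), AvoidsCliques C a univ → (N : ℝ) ≤ X) :
    (ramseyNumber r (fun i => a i + 2) : ℝ) ≤ X + 1 := by
  have hle : ramseyNumber r (fun i => a i + 2) ≤ ⌊X⌋₊ + 1 := by
    refine Nat.sInf_le fun C => ?_
    by_contra hC
    have := h _ C (AvoidsCliques.of_not_ramseyProp hC)
    push_cast at this
    exact absurd this (not_le.mpr (Nat.lt_floor_add_one X))
  calc (ramseyNumber r (fun i => a i + 2) : ℝ) ≤ (⌊X⌋₊ : ℝ) + 1 := by exact_mod_cast hle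
    _ ≤ X + 1 := by gcongr; exact Nat.floor_le hX

/-- When every `a i` is at most one, only the colors with `a i = 1` matter. -/
lemma AvoidsCliques.card_lt_ramseyNumber {V ι : Type*} [DecidableEq V] [DecidableEq ι] [Fintype ι]
    {C : Sym2 V → ι} {a : ι → ℕ} {S : Finset V} {s : ℕ} (hs : 0 < s) (ha : ∀ i, a i ≤ 1)
    (hsum : ∑ i, a i = s) (h : AvoidsCliques C a S) :
    S.card < ramseyNumber s fun _ => 3 := by
  by_contra! hle
  have hcard : (univ.filter fun i => a i = 1).card = s := by
    rw [← hsum, card_filter]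
    refine sum_congr rfl fun i _ => ?_
    have := ha i
    split_ifs <;> omega
  let e := (univ.filter fun i => a i = 1).equivFinOfCardEq hcard
  obtain ⟨T, hTS, hT⟩ := exists_subset_card_eq hle
  let f := (T.equivFinOfCardEq hT).symm
  have hf : Function.Injective fun x => (f x : V) := Subtype.val_injective.comp f.injective
  have hfS : ∀ x, (f x : V) ∈ S := fun x => hTS (f x).2
  let color : ι → Fin s := fun i =>
    if hi : i ∈ univ.filter fun i => a i = 1 then e ⟨i, hi⟩ else ⟨0, hs⟩
  obtain ⟨i, U, hU, hmono⟩ := ramseyProp_ramseyNumber (fun _ : Fin s => 1)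
    fun z => color (C (z.map fun x => (f x : V)))
  have := h (e.symm i) (U.map ⟨_, hf⟩) (by
      intro x hx
      obtain ⟨u, -, rfl⟩ := mem_map.mp hx
      exact hfS u) (by
    intro x hx y hy hxy
    obtain ⟨u, hu, rfl⟩ := mem_map.mp hx
    obtain ⟨w, hw, rfl⟩ := mem_map.mp hy
    simp only [Function.Embedding.coeFn_mk] at hxy ⊢
    have hmem : C s((f u : V), (f w : V)) ∈ univ.filter fun i => a i = 1 := by
      have h1 := h.color_ne_zero (hfS u) (hfS w) hxy
      have h2 := ha (C s((f u : V), (f w : V)))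
      simp only [mem_filter, mem_univ, true_and]
      omega
    have hc := hmono u hu w hw (fun huw => hxy (by rw [huw]))
    simp only [Sym2.map_mk, color] at hc
    rw [dif_pos hmem] at hc
    rw [← hc, Equiv.symm_apply_apply])
  have hi := ha (e.symm i)
  rw [card_map, hU] at this
  dsimp only at this
  omega

lemma AvoidsCliques.card_mul_prod_factorial_le_of_ramseyNumber {V ι : Type*} [DecidableEq V]
    [DecidableEq ι] [Fintype ι] {C : Sym2 V → ι} {a : ι → ℕ} {S : Finset V} {K s : ℕ} {A : ℝ}
    (hs : 2 ≤ s) (hA : (ramseyNumber s (fun _ => 3) : ℝ) ≤ A * s.factorial)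
    (haK : ∀ i, a i ≤ K) (hsum : ∑ i, a i = s) (h : AvoidsCliques C a S) :
    (S.card : ℝ) * ∏ i, ((a i).factorial : ℝ) ≤ s.factorial * A +
      ((s + 1).factorial * (K : ℝ) ^ s) * (s - 2).factorial * ∑ i, (a i : ℝ) * (a i - 1) := by
  have hnn : ∀ i, 0 ≤ (a i : ℝ) * (a i - 1) := by
    intro i
    rcases Nat.eq_zero_or_pos (a i) with hi | hi
    · simp [hi]
    · have : (1 : ℝ) ≤ a i := by exact_mod_cast hi
      exact mul_nonneg (by linarith) (by linarith)
  by_cases ha : ∀ i, a i ≤ 1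
  · have hp : ∏ i, ((a i).factorial : ℝ) = 1 :=
      prod_eq_one fun i _ => by rw [Nat.factorial_eq_one.mpr (ha i), Nat.cast_one]
    have hlt : (S.card : ℝ) ≤ ramseyNumber s fun _ => 3 := by
      exact_mod_cast (h.card_lt_ramseyNumber (by omega) ha hsum).le
    have hQ : 0 ≤ ∑ i, (a i : ℝ) * (a i - 1) := sum_nonneg fun i _ => hnn i
    have : 0 ≤ ((s + 1).factorial * (K : ℝ) ^ s) * (s - 2).factorial *
      ∑ i, (a i : ℝ) * (a i - 1) := by positivity
    rw [hp, mul_one]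
    linarith
  · push Not at ha
    obtain ⟨i, hi⟩ := ha
    have hi2 : (2 : ℝ) ≤ a i := by exact_mod_cast hi
    have hQ : 1 ≤ ∑ i, (a i : ℝ) * (a i - 1) :=
      le_trans (by nlinarith) (single_le_sum (fun j _ => hnn j) (mem_univ i))
    have hp : ∏ i, ((a i).factorial : ℝ) ≤ (K : ℝ) ^ s := by
      rw [← hsum]; exact_mod_cast prod_factorial_le_pow_sum haK
    have hS : (S.card : ℝ) ≤ (s + 1).factorial := by
      rw [← hsum]; exact_mod_cast h.card_le_factorial
    have hf : (1 : ℝ) ≤ (s - 2).factorial := by exact_mod_cast Nat.factorial_pos _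
    have hR : (0 : ℝ) ≤ ramseyNumber s fun _ => 3 := Nat.cast_nonneg _
    calc (S.card : ℝ) * ∏ i, ((a i).factorial : ℝ) ≤ (s + 1).factorial * (K : ℝ) ^ s := by gcongr
      _ ≤ ((s + 1).factorial * (K : ℝ) ^ s) * ((s - 2).factorial *
          ∑ i, (a i : ℝ) * (a i - 1)) :=
        le_mul_of_one_le_right (by positivity) (one_le_mul_of_one_le_of_one_le hf hQ)
      _ ≤ _ := by rw [← mul_assoc]; linarith

/-- A bound for the triangle Ramsey number at a single number of colors `s` bounds all diagonal
Ramsey numbers with at least `s` colors. -/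
lemma ramseyNumber_add_two_le {K s r : ℕ} {A : ℝ} (hK : 0 < K) (hs : 2 ≤ s) (hr : s ≤ r)
    (hA : (ramseyNumber s (fun _ => 3) : ℝ) ≤ A * s.factorial) :
    (ramseyNumber r (fun _ => K + 2) : ℝ) ≤
      (A + (Real.exp K - ∑ m ∈ range (s + 1), (K : ℝ) ^ m / m.factorial) +
        (s + 1).factorial * (K : ℝ) ^ s * ((K - 1) / ((r * K : ℕ) - 1)) +
        (K : ℝ) ^ (r * K) / (r * K).factorial) *
      (r * K).factorial / (K.factorial : ℝ) ^ r := by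
  have hn : s ≤ r * K := hr.trans (Nat.le_mul_of_pos_right r hK)
  have hn2 : (2 : ℝ) ≤ (r * K : ℕ) := by exact_mod_cast hs.trans hn
  have hK1 : (1 : ℝ) ≤ K := by exact_mod_cast hK
  have hfpos : (0 : ℝ) < (K.factorial : ℝ) ^ r := by positivity
  have hA0 : 0 ≤ A := by
    by_contra! hneg
    have : A * (s.factorial : ℝ) < 0 := mul_neg_of_neg_of_pos hneg (by positivity)
    have : (0 : ℝ) ≤ ramseyNumber s fun _ => 3 := Nat.cast_nonneg _
    linarith
  have hexp : ∀ n : ℕ, ∑ m ∈ range n, (K : ℝ) ^ m / m.factorial ≤ Real.exp K :=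
    Real.sum_le_exp_of_nonneg (Nat.cast_nonneg K)
  have hD : (0 : ℝ) ≤ (s + 1).factorial * (K : ℝ) ^ s * ((K - 1) / ((r * K : ℕ) - 1)) :=
    mul_nonneg (by positivity) (div_nonneg (by linarith) (by linarith))
  set Y : ℝ := A + (Real.exp K - ∑ m ∈ range (s + 1), (K : ℝ) ^ m / m.factorial) +
    (s + 1).factorial * (K : ℝ) ^ s * ((K - 1) / ((r * K : ℕ) - 1)) with hY
  have hY0 : 0 ≤ Y := by linarith [hexp (s + 1)]
  have hbound : (ramseyNumber r (fun _ => K + 2) : ℝ) ≤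
      Y * (r * K).factorial / (K.factorial : ℝ) ^ r + 1 := by
    refine ramseyNumber_le_add_one (a := fun _ => K) (by positivity) fun N C hC => ?_
    have hmain := hC.card_mul_prod_factorial_le hs
      (fun a S haK ha h => h.card_mul_prod_factorial_le_of_ramseyNumber hs hA haK ha)
      hn (fun _ => le_rfl) (by simp)
    simp only [prod_const, sum_const, card_univ, Fintype.card_fin, nsmul_eq_mul] at hmain
    rw [le_div_iff₀ hfpos]
    refine hmain.trans ?_
    have hfac : ((r * K).factorial : ℝ) =
        (r * K : ℕ) * (((r * K : ℕ) - 1) * (r * K - 2).factorial) := by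
      obtain ⟨m, hm⟩ : ∃ m, r * K = m + 2 := ⟨r * K - 2, by omega⟩
      rw [hm, show m + 2 - 2 = m by omega, Nat.factorial_succ, Nat.factorial_succ]
      push_cast; ring
    have hlast : ((s + 1).factorial * (K : ℝ) ^ s) * (r * K - 2).factorial *
        (r * (K * (K - 1))) = (s + 1).factorial * (K : ℝ) ^ s * ((K - 1) / ((r * K : ℕ) - 1)) *
          (r * K).factorial := by
      have : ((r * K : ℕ) : ℝ) - 1 ≠ 0 := by linarith
      rw [hfac]
      field_simp
      push_cast
      ring
    rw [hlast, hY, add_mul, mul_comm ((r * K).factorial : ℝ)]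
    gcongr
    exact hexp _
  refine hbound.trans ?_
  rw [add_mul Y, add_div, div_mul_cancel₀ _ (by positivity)]
  gcongr
  rw [one_le_div hfpos]
  have := prod_factorial_le_pow_sum (ι := Fin r) (a := fun _ => K) (fun _ => le_rfl)
  simp only [prod_const, sum_const, card_univ, Fintype.card_fin, smul_eq_mul] at this
  exact_mod_cast this

theorem stmt_19 (k : ℕ) (hk : 4 ≤ k) (c : ℝ) (hc : 0 < c)
    (h : ∀ ε : ℝ, 0 < ε → ∀ᶠ r : ℕ in Filter.atTop,
      (ramseyNumber r (fun _ => 3) : ℝ) ≤ (3 - c + ε) * r.factorial) :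
    ∀ ε : ℝ, 0 < ε → ∀ᶠ r : ℕ in Filter.atTop,
      (ramseyNumber r (fun _ => k) : ℝ) ≤
        (3 - c / 2 + ε) * ((r * (k - 2)).factorial : ℝ) / ((k - 2).factorial : ℝ) ^ r := by
  intro ε hε
  obtain ⟨K, rfl⟩ : ∃ K, k = K + 2 := ⟨k - 2, by omega⟩
  rw [Nat.add_sub_cancel]
  have hK : 0 < K := by omega
  have hE : Tendsto (fun n : ℕ => Real.exp K - ∑ m ∈ range (n + 1), (K : ℝ) ^ m / m.factorial)
      atTop (nhds 0) := by
    have hsum : HasSum (fun m : ℕ => (K : ℝ) ^ m / m.factorial) (Real.exp K) := by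
      rw [Real.exp_eq_exp_ℝ]
      exact NormedSpace.expSeries_div_hasSum_exp (K : ℝ)
    simpa using (hsum.tendsto_sum_nat.comp (tendsto_add_atTop_nat 1)).const_sub (Real.exp K)
  obtain ⟨s, hA, hs, hEs⟩ := ((h (c / 8) (by positivity)).and
    ((eventually_ge_atTop 2).and (hE.eventually_lt_const (show 0 < c / 8 by positivity)))).exists
  have hrK : Tendsto (fun r : ℕ => r * K) atTop atTop := tendsto_id.atTop_mul_const' hK
  have hQ : Tendsto (fun r : ℕ => (s + 1).factorial * (K : ℝ) ^ s *
      (((K : ℝ) - 1) / ((r * K : ℕ) - 1))) atTop (nhds 0) := by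
    have : Tendsto (fun r : ℕ => ((r * K : ℕ) : ℝ) - 1) atTop atTop :=
      tendsto_atTop_add_const_right _ (-1) (tendsto_natCast_atTop_atTop.comp hrK)
    simpa using (this.const_div_atTop ((K : ℝ) - 1)).const_mul ((s + 1).factorial * (K : ℝ) ^ s)
  have hF : Tendsto (fun r : ℕ => (K : ℝ) ^ (r * K) / (r * K).factorial) atTop (nhds 0) :=
    (FloorSemiring.tendsto_pow_div_factorial_atTop (K : ℝ)).comp hrK
  filter_upwards [eventually_ge_atTop s, hQ.eventually_lt_const (show 0 < c / 8 by positivity),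
    hF.eventually_lt_const (show 0 < c / 8 by positivity)] with r hr hQr hFr
  refine (ramseyNumber_add_two_le hK hs hr hA).trans ?_
  refine div_le_div_of_nonneg_right (mul_le_mul_of_nonneg_right ?_ ?_) ?_
  · linarith
  all_goals positivity
end
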